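/- R(K₃+e, K₄−e) = 7. -/

import Mathlib

open SimpleGraph

/-- `G` contains a subgraph isomorphic to `H`:
there is an injective map from the vertices of `H` to those of `G` preserving adjacency. -/
def Contains {V W : Type*} (G : SimpleGraph V) (H : SimpleGraph W) : Prop :=
  ∃ f : W → V, Function.Injective f ∧ ∀ ⦃a b : W⦄, H.Adj a b → G.Adj (f a) (f b)

/-- The triangle `K₃`. -/
def triangle : SimpleGraph (Fin 3) := ⊤

/-- The paw graph `K₃ + e`: a triangle `{0, 1, 2}` with a pendant edge `{2, 3}`. -/
def paw : SimpleGraph (Fin 4) :=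
  SimpleGraph.fromEdgeSet {s(0, 1), s(0, 2), s(1, 2), s(2, 3)}

/-- `J₄ = K₄ - e`, the complete graph on 4 vertices with one edge deleted. -/
def J4 : SimpleGraph (Fin 4) := (⊤ : SimpleGraph (Fin 4)).deleteEdges {s(0, 1)}

/-- The graph formed by the edges of color `i` in the edge coloring `c` of `K_n`. -/
def colorClass {n m : ℕ} (c : Sym2 (Fin n) → Fin m) (i : Fin m) : SimpleGraph (Fin n) :=
  SimpleGraph.fromEdgeSet {e | c e = i}

/-- A `(G1, G2; n)`-coloring: a 2-coloring of the edges of `K_n` such that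
color `i` contains no subgraph isomorphic to `Gi`. -/
def GoodColoring2 {a b : ℕ} (G1 : SimpleGraph (Fin a)) (G2 : SimpleGraph (Fin b))
    (n : ℕ) : Prop :=
  ∃ c : Sym2 (Fin n) → Fin 2,
    ¬ Contains (colorClass c 0) G1 ∧ ¬ Contains (colorClass c 1) G2

/-- The 2-color Ramsey number `R(G1, G2)`:
the least `n` such that no `(G1, G2; n)`-coloring exists. -/
noncomputable def Ramsey2 {a b : ℕ} (G1 : SimpleGraph (Fin a))
    (G2 : SimpleGraph (Fin b)) : ℕ :=
  sInf {n : ℕ | ¬ GoodColoring2 G1 G2 n}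

lemma colorClass_adj {n m : ℕ} (c : Sym2 (Fin n) → Fin m) (i : Fin m) (u v : Fin n) :
    (colorClass c i).Adj u v ↔ c s(u, v) = i ∧ u ≠ v := by
  simp [colorClass]

lemma colorClass_one_eq_compl {n : ℕ} (c : Sym2 (Fin n) → Fin 2) :
    colorClass c 1 = (colorClass c 0)ᶜ := by
  ext u v
  rw [SimpleGraph.compl_adj, colorClass_adj, colorClass_adj]
  have : c s(u, v) = 0 ∨ c s(u, v) = 1 := by omega
  grind

lemma contains_paw {V : Type*} {G : SimpleGraph V} {a b c d : V} (hab : G.Adj a b)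
    (hac : G.Adj a c) (hbc : G.Adj b c) (hcd : G.Adj c d) (had : a ≠ d) (hbd : b ≠ d) :
    Contains G paw := by
  have h1 := hab.ne
  have h2 := hac.ne
  have h3 := hbc.ne
  have h4 := hcd.ne
  refine ⟨![a, b, c, d], ?_, ?_⟩
  · intro i j
    fin_cases i <;> fin_cases j <;> simp <;> grind
  · intro i j
    fin_cases i <;> fin_cases j <;>
      simp [paw, hab, hac, hbc, hcd, hab.symm, hac.symm, hbc.symm, hcd.symm]

lemma contains_J4 {V : Type*} {G : SimpleGraph V} {a b c d : V} (hac : G.Adj a c)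
    (had : G.Adj a d) (hbc : G.Adj b c) (hbd : G.Adj b d) (hcd : G.Adj c d) (hab : a ≠ b) :
    Contains G J4 := by
  have h1 := hac.ne
  have h2 := had.ne
  have h3 := hbc.ne
  have h4 := hbd.ne
  have h5 := hcd.ne
  refine ⟨![a, b, c, d], ?_, ?_⟩
  · intro i j
    fin_cases i <;> fin_cases j <;> simp <;> grind
  · intro i j
    fin_cases i <;> fin_cases j <;>
      simp [J4, hac, had, hbc, hbd, hcd, hac.symm, had.symm, hbc.symm, hbd.symm, hcd.symm]

/-- A graph on at least seven vertices with no paw, whose complement has no `J₄`,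
is triangle-free. -/
lemma not_triangle {V : Type*} [Fintype V] {G : SimpleGraph V} (hV : 7 ≤ Fintype.card V)
    (hG : ¬ Contains G paw) (hGc : ¬ Contains Gᶜ J4) {a b c : V} (hab : G.Adj a b)
    (hac : G.Adj a c) (hbc : G.Adj b c) : False := by
  classical
  have out : ∀ d, d ∉ ({a, b, c} : Finset V) → Gᶜ.Adj a d ∧ Gᶜ.Adj b d := by
    intro d hd
    simp only [Finset.mem_insert, Finset.mem_singleton, not_or] at hd
    obtain ⟨hda, hdb, hdc⟩ := hd
    simp only [SimpleGraph.compl_adj]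
    rw [← ne_eq, ne_comm] at hda hdb hdc
    exact ⟨⟨hda, fun h => hG (contains_paw hbc hab.symm hac.symm h hdb hdc)⟩,
      ⟨hdb, fun h => hG (contains_paw hac hab hbc.symm h hda hdc)⟩⟩
  have red : ∀ d e, d ∉ ({a, b, c} : Finset V) → e ∉ ({a, b, c} : Finset V) → d ≠ e →
      G.Adj d e := by
    intro d e hd he hde
    by_contra h
    exact hGc (contains_J4 (out d hd).1 (out e he).1 (out d hd).2 (out e he).2
      ((SimpleGraph.compl_adj ..).2 ⟨hde, h⟩) hab.ne)
  have hcard : 4 ≤ (({a, b, c} : Finset V)ᶜ).card := by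
    rw [Finset.card_compl]
    have : ({a, b, c} : Finset V).card ≤ 3 := Finset.card_le_three
    omega
  obtain ⟨s, hs, hs4⟩ := Finset.exists_subset_card_eq hcard
  obtain ⟨d, e, f, g, hde, hdf, hdg, hef, heg, hfg, rfl⟩ := Finset.card_eq_four.1 hs4
  have mem : ∀ x ∈ ({d, e, f, g} : Finset V), x ∉ ({a, b, c} : Finset V) :=
    fun x hx => Finset.mem_compl.1 (hs hx)
  have hd := mem d (by simp)
  have he := mem e (by simp)
  have hf := mem f (by simp)
  have hg := mem g (by simp)
  exact hG (contains_paw (red d e hd he hde) (red d f hd hf hdf) (red e f he hf hef)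
    (red f g hf hg hfg) hdg heg)

/-- If `G` is triangle-free and its complement has no `J₄`, then four non-neighbours of a vertex
`v` span no edge of the complement, as long as there is a sixth vertex `x`. -/
lemma no_four_nonneighbors_of_edge {V : Type*} {G : SimpleGraph V}
    (htri : ∀ ⦃a b c⦄, G.Adj a b → G.Adj a c → G.Adj b c → False) (hGc : ¬ Contains Gᶜ J4)
    {v a b c d x : V} (hva : Gᶜ.Adj v a) (hvb : Gᶜ.Adj v b) (hvc : Gᶜ.Adj v c)
    (hvd : Gᶜ.Adj v d) (hab : Gᶜ.Adj a b) (hac : a ≠ c) (had : a ≠ d) (hbc : b ≠ c)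
    (hbd : b ≠ d) (hcd : c ≠ d) (hxv : x ≠ v) (hxa : x ≠ a) (hxb : x ≠ b) (hxc : x ≠ c)
    (hxd : x ≠ d) : False := by
  have hJ : ∀ ⦃p q s t⦄, Gᶜ.Adj p s → Gᶜ.Adj p t → Gᶜ.Adj q s → Gᶜ.Adj q t → Gᶜ.Adj s t →
      p ≠ q → False := fun p q s t h1 h2 h3 h4 h5 h6 => hGc (contains_J4 h1 h2 h3 h4 h5 h6)
  have col : ∀ ⦃p q⦄, p ≠ q → ¬ Gᶜ.Adj p q → G.Adj p q := by
    intro p q h h'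
    simpa [SimpleGraph.compl_adj, h] using h'
  have rac : G.Adj a c := col hac fun h => hJ hab.symm hvb.symm h.symm hvc.symm hva.symm hbc
  have rad : G.Adj a d := col had fun h => hJ hab.symm hvb.symm h.symm hvd.symm hva.symm hbd
  have bcd : Gᶜ.Adj c d := (SimpleGraph.compl_adj ..).2 ⟨hcd, fun h => htri rac rad h⟩
  have rbc : G.Adj b c := col hbc fun h => hJ hab hva.symm h.symm hvc.symm hvb.symm hac
  have rbd : G.Adj b d := col hbd fun h => hJ hab hva.symm h.symm hvd.symm hvb.symm had
  have key : ∀ ⦃y⦄, G.Adj y c → G.Adj y d → G.Adj x y → False := by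
    intro y hc hd hy
    exact hJ ((SimpleGraph.compl_adj ..).2 ⟨hxc, fun h => htri hy h hc⟩)
      ((SimpleGraph.compl_adj ..).2 ⟨hxd, fun h => htri hy h hd⟩) hvc hvd bcd hxv
  exact hJ ((SimpleGraph.compl_adj ..).2 ⟨hxa, key rac rad⟩)
    ((SimpleGraph.compl_adj ..).2 ⟨hxb, key rbc rbd⟩) hva hvb hab hxv

lemma not_goodColoring2_paw_J4_seven : ¬ GoodColoring2 paw J4 7 := by
  classical
  rintro ⟨c, hG, hGc⟩
  rw [colorClass_one_eq_compl] at hGc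
  generalize colorClass c 0 = G at hG hGc
  have htri : ∀ ⦃a b c⦄, G.Adj a b → G.Adj a c → G.Adj b c → False :=
    fun a b c => not_triangle (by simp) hG hGc
  have compl : ∀ ⦃p q⦄, p ≠ q → ¬ G.Adj p q → Gᶜ.Adj p q :=
    fun p q h h' => (SimpleGraph.compl_adj ..).2 ⟨h, h'⟩
  have hle : ∀ v, G.degree v ≤ 3 := by
    intro v
    by_contra! h
    obtain ⟨s, hs, hs4⟩ := Finset.exists_subset_card_eq (Nat.succ_le_of_lt h)
    obtain ⟨p, q, r, t, hpq, hpr, hpt, hqr, hqt, hrt, rfl⟩ := Finset.card_eq_four.1 hs4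
    simp only [Finset.insert_subset_iff, Finset.singleton_subset_iff,
      SimpleGraph.mem_neighborFinset] at hs
    obtain ⟨hp, hq, hr, ht⟩ := hs
    exact hGc (contains_J4 (compl hpr (htri hp hr)) (compl hpt (htri hp ht))
      (compl hqr (htri hq hr)) (compl hqt (htri hq ht)) (compl hrt (htri hr ht)) hpq)
  have hge : ∀ v, 3 ≤ G.degree v := by
    intro v
    by_contra! h
    have hc : 4 ≤ Gᶜ.degree v := by
      rw [SimpleGraph.degree_compl, Fintype.card_fin]
      omega
    obtain ⟨s, hs, hs4⟩ := Finset.exists_subset_card_eq hc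
    obtain ⟨x, -, hx⟩ := Finset.exists_mem_notMem_of_card_lt_card
      (s := insert v s) (t := Finset.univ)
      ((Finset.card_insert_le v s).trans_lt (by simp [hs4]))
    obtain ⟨p, q, r, t, hpq, hpr, hpt, hqr, hqt, hrt, rfl⟩ := Finset.card_eq_four.1 hs4
    simp only [Finset.insert_subset_iff, Finset.singleton_subset_iff,
      SimpleGraph.mem_neighborFinset] at hs
    obtain ⟨hp, hq, hr, ht⟩ := hs
    simp only [Finset.mem_insert, Finset.mem_singleton, not_or] at hx
    obtain ⟨xv, xp, xq, xr, xt⟩ := hx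
    have apq : G.Adj p q := by
      by_contra hn
      exact no_four_nonneighbors_of_edge htri hGc hp hq hr ht (compl hpq hn)
        hpr hpt hqr hqt hrt xv xp xq xr xt
    have apr : G.Adj p r := by
      by_contra hn
      exact no_four_nonneighbors_of_edge htri hGc hp hr hq ht (compl hpr hn)
        hpq hpt hqr.symm hrt hqt xv xp xr xq xt
    have aqr : G.Adj q r := by
      by_contra hn
      exact no_four_nonneighbors_of_edge htri hGc hq hr hp ht (compl hqr hn)
        hpq.symm hqt hpr.symm hrt hpt xv xq xr xp xt
    exact htri apq apr aqr
  have hsum := G.sum_degrees_eq_twice_card_edges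
  simp only [fun v => le_antisymm (hle v) (hge v), Finset.sum_const, Finset.card_univ,
    Fintype.card_fin, smul_eq_mul] at hsum
  omega

/-- Restricting a good coloring to fewer vertices. -/
lemma GoodColoring2.mono {a b : ℕ} {G1 : SimpleGraph (Fin a)} {G2 : SimpleGraph (Fin b)}
    {m n : ℕ} (hmn : m ≤ n) (h : GoodColoring2 G1 G2 n) : GoodColoring2 G1 G2 m := by
  obtain ⟨c, h1, h2⟩ := h
  have inj := Fin.castLE_injective hmn
  have lift : ∀ (i : Fin 2) {k : ℕ} (H : SimpleGraph (Fin k)),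
      Contains (colorClass (fun e => c (e.map (Fin.castLE hmn))) i) H →
      Contains (colorClass c i) H := by
    rintro i k H ⟨f, hf, hadj⟩
    refine ⟨Fin.castLE hmn ∘ f, inj.comp hf, fun u v huv => ?_⟩
    have := hadj huv
    rw [colorClass_adj] at this ⊢
    exact ⟨this.1, inj.ne this.2⟩
  exact ⟨_, fun h => h1 (lift 0 _ h), fun h => h2 (lift 1 _ h)⟩

/-- Color the edges between vertices of different parity with color `0`:
color `0` is then `K₃,₃` and color `1` is a pair of disjoint triangles. -/
lemma goodColoring2_paw_J4_six : GoodColoring2 paw J4 6 := by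
  let c : Sym2 (Fin 6) → Fin 2 := Sym2.lift
    ⟨fun u v => if u.val % 2 = v.val % 2 then 1 else 0, fun u v => by simp only [eq_comm]⟩
  have hc : ∀ u v : Fin 6, c s(u, v) = if u.val % 2 = v.val % 2 then 1 else 0 := fun _ _ => rfl
  refine ⟨c, ?_, ?_⟩
  · rintro ⟨f, -, hadj⟩
    have h01 := hadj (show paw.Adj 0 1 by simp [paw])
    have h02 := hadj (show paw.Adj 0 2 by simp [paw])
    have h12 := hadj (show paw.Adj 1 2 by simp [paw])
    rw [colorClass_adj, hc] at h01 h02 h12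
    simp only [ite_eq_right_iff, one_ne_zero, imp_false] at h01 h02 h12
    omega
  · rintro ⟨f, hf, hadj⟩
    have h02 := hadj (show J4.Adj 0 2 by simp [J4])
    have h03 := hadj (show J4.Adj 0 3 by simp [J4])
    have h12 := hadj (show J4.Adj 1 2 by simp [J4])
    have h23 := hadj (show J4.Adj 2 3 by simp [J4])
    have h13 := hadj (show J4.Adj 1 3 by simp [J4])
    have h01 : f 0 ≠ f 1 := hf.ne (by decide)
    rw [colorClass_adj, hc] at h02 h03 h12 h23 h13
    grind

/-- `R(K₃+e, K₄-e) = 7`. -/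
theorem ramsey_paw_J4_eq_7 : Ramsey2 paw J4 = 7 := by
  refine le_antisymm (Nat.sInf_le not_goodColoring2_paw_J4_seven) ?_
  refine le_csInf ⟨7, not_goodColoring2_paw_J4_seven⟩ fun n hn => ?_
  by_contra! h
  exact hn (goodColoring2_paw_J4_six.mono (by omega))
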